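/- arXiv:1510.02848 — 5 statements merged into one kernel-verified Lean document; each statement's English description precedes it below -/
import Mathlib

section
/- Suppose G and the subgraph G_I induced on the interior nodes I are connected. Then for every conductivity γ ∈ ℂ_0^E there exists a real number ζ < 0 such that for every q ∈ ℂ_ζ^I the matrix (L_γ)_{II} + diag(q) is invertible, i.e. the Dirichlet problem for (γ,q) is well-posed. -/
/-!
Common setup: a finite graph whose vertex set is partitioned into boundary
nodes `B` and interior nodes `I` (so the vertex set is `B ⊕ I`), with edge
set `E` and a fixed orientation given by maps `head tail : E → B ⊕ I`.
-/

open Matrix MeasureTheory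

namespace DIP

noncomputable section

variable {B I E : Type*} [Fintype B] [Fintype I] [Fintype E]
  [DecidableEq B] [DecidableEq I] [DecidableEq E]

/-- Discrete gradient: `(∇u)(e) = u(head e) - u(tail e)`. -/
def grad (head tail : E → B ⊕ I) (u : B ⊕ I → ℂ) : E → ℂ :=
  fun e => u (head e) - u (tail e)

/-- Signed incidence matrix over a commutative ring `α`. -/
def incMat (α : Type*) [CommRing α] (head tail : E → B ⊕ I) : Matrix E (B ⊕ I) α :=
  Matrix.of fun e v => (if v = head e then (1 : α) else 0) - (if v = tail e then (1 : α) else 0)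

/-- Weighted graph Laplacian `L_γ = ∇ᵀ diag(γ) ∇`. -/
def lap (α : Type*) [CommRing α] (head tail : E → B ⊕ I) (γ : E → α) :
    Matrix (B ⊕ I) (B ⊕ I) α :=
  (incMat α head tail)ᵀ * Matrix.diagonal γ * incMat α head tail

/-- The `II` block of the weighted graph Laplacian. -/
def lapII (α : Type*) [CommRing α] (head tail : E → B ⊕ I) (γ : E → α) : Matrix I I α :=
  (lap α head tail γ).submatrix Sum.inr Sum.inr

/-- The `IB` block of the weighted graph Laplacian. -/
def lapIB (α : Type*) [CommRing α] (head tail : E → B ⊕ I) (γ : E → α) : Matrix I B α :=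
  (lap α head tail γ).submatrix Sum.inr Sum.inl

/-- The `BI` block of the weighted graph Laplacian. -/
def lapBI (α : Type*) [CommRing α] (head tail : E → B ⊕ I) (γ : E → α) : Matrix B I α :=
  (lap α head tail γ).submatrix Sum.inl Sum.inr

/-- The `BB` block of the weighted graph Laplacian. -/
def lapBB (α : Type*) [CommRing α] (head tail : E → B ⊕ I) (γ : E → α) : Matrix B B α :=
  (lap α head tail γ).submatrix Sum.inl Sum.inl

/-- Dirichlet-to-Neumann map
`Λ_{γ,q} = (L_γ)_BB - (L_γ)_BI [(L_γ)_II + diag(q)]⁻¹ (L_γ)_IB`. -/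
def dtn (head tail : E → B ⊕ I) (γ : E → ℂ) (q : I → ℂ) : Matrix B B ℂ :=
  lapBB ℂ head tail γ -
    lapBI ℂ head tail γ * (lapII ℂ head tail γ + Matrix.diagonal q)⁻¹ * lapIB ℂ head tail γ

/-- `u` is `(γ,q)`-harmonic: `(L_γ u)_I + q ⊙ u_I = 0`. -/
def Harmonic (head tail : E → B ⊕ I) (γ : E → ℂ) (q : I → ℂ) (u : B ⊕ I → ℂ) : Prop :=
  ∀ i : I, (lap ℂ head tail γ).mulVec u (Sum.inr i) + q i * u (Sum.inr i) = 0

/-- The graph `G` is connected. -/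
def Gconn (head tail : E → B ⊕ I) : Prop :=
  (SimpleGraph.fromRel fun v w : B ⊕ I => ∃ e, head e = v ∧ tail e = w).Connected

/-- The subgraph of `G` induced on the interior nodes is connected. -/
def GIconn (head tail : E → B ⊕ I) : Prop :=
  (SimpleGraph.fromRel fun i j : I => ∃ e, head e = Sum.inr i ∧ tail e = Sum.inr j).Connected

/-- `P(γ₁,γ₂)`: span of Hadamard products of gradients of harmonic functions. -/
def Pspace (head tail : E → B ⊕ I) (γ₁ γ₂ : E → ℂ) : Submodule ℂ (E → ℂ) :=
  Submodule.span ℂ { w : E → ℂ | ∃ u v : B ⊕ I → ℂ,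
    Harmonic head tail γ₁ 0 u ∧ Harmonic head tail γ₂ 0 v ∧
    w = fun e => grad head tail u e * grad head tail v e }

/-- `Q(q₁,q₂)`: span of Hadamard products of interior values of harmonic functions. -/
def Qspace (head tail : E → B ⊕ I) (γ : E → ℂ) (q₁ q₂ : I → ℂ) : Submodule ℂ (I → ℂ) :=
  Submodule.span ℂ { w : I → ℂ | ∃ u v : B ⊕ I → ℂ,
    Harmonic head tail γ q₁ u ∧ Harmonic head tail γ q₂ v ∧
    w = fun i => u (Sum.inr i) * v (Sum.inr i) }

/-- The matrix `U(γ)` whose `i`-th column is the harmonic extension of the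
standard basis vector `e_i ∈ ℂ^B`. -/
def Usol (head tail : E → B ⊕ I) (γ : E → ℂ) : Matrix (B ⊕ I) B ℂ :=
  Matrix.of (Sum.elim (fun b i => if b = i then (1 : ℂ) else 0)
    (fun j i => (-((lapII ℂ head tail γ)⁻¹ * lapIB ℂ head tail γ)) j i))

/-- The products-of-gradients matrix `F(γ₁,γ₂) ∈ ℂ^{|E| × |B|²}` whose column
indexed by `(i,j)` is `(∇ U(γ₁))_{:,i} ⊙ (∇ U(γ₂))_{:,j}`. -/
def Fmat (head tail : E → B ⊕ I) (γ₁ γ₂ : E → ℂ) : Matrix E (B × B) ℂ :=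
  Matrix.of fun e p =>
    grad head tail (fun v => Usol head tail γ₁ v p.1) e *
    grad head tail (fun v => Usol head tail γ₂ v p.2) e

/-- Smallest eigenvalue of a real symmetric matrix, as the minimum of its
Rayleigh quotient over the (Euclidean) unit sphere. -/
def lambdaMin (M : Matrix I I ℝ) : ℝ :=
  ⨅ x : { x : I → ℝ // ∑ i, x i ^ 2 = 1 }, (x : I → ℝ) ⬝ᵥ M.mulVec (x : I → ℝ)


theorem aux_inc (head tail : E → B ⊕ I) (x : I → ℂ) (e : E) :
    ((incMat ℂ head tail).submatrix id Sum.inr *ᵥ x) e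
      = Sum.elim (0 : B → ℂ) x (head e) - Sum.elim (0 : B → ℂ) x (tail e) := by
  have key : ∀ v : B ⊕ I, ∑ i : I, (if Sum.inr i = v then (1 : ℂ) else 0) * x i
      = Sum.elim (0 : B → ℂ) x v := by
    rintro (b | j)
    · simp
    · simp
  simp only [Matrix.mulVec, dotProduct, incMat, Matrix.submatrix_apply, Matrix.of_apply, sub_mul,
    Finset.sum_sub_distrib, id, key]

theorem aux_form (head tail : E → B ⊕ I) (γ : E → ℂ) (x : I → ℂ) :
    star x ⬝ᵥ (lapII ℂ head tail γ *ᵥ x) =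
      ∑ e, γ e * ((‖Sum.elim (0 : B → ℂ) x (head e)
        - Sum.elim (0 : B → ℂ) x (tail e)‖ ^ 2 : ℝ) : ℂ) := by
  have h1 : lapII ℂ head tail γ = ((incMat ℂ head tail).submatrix id Sum.inr)ᵀ *
      Matrix.diagonal γ * (incMat ℂ head tail).submatrix id Sum.inr := by
    ext i j
    simp [lapII, lap, Matrix.mul_apply, Matrix.submatrix_apply]
  rw [h1, ← Matrix.mulVec_mulVec, ← Matrix.mulVec_mulVec, Matrix.dotProduct_mulVec,
    Matrix.vecMul_transpose, dotProduct]
  refine Finset.sum_congr rfl fun e _ => ?_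
  rw [Matrix.mulVec_diagonal, aux_inc, aux_inc]
  have h2 : ∀ v : B ⊕ I, Sum.elim (0 : B → ℂ) (star x) v
      = (starRingEnd ℂ) (Sum.elim (0 : B → ℂ) x v) := by
    rintro (b | j) <;> simp
  rw [h2, h2, ← map_sub, mul_left_comm, ← Complex.normSq_eq_norm_sq, Complex.normSq_eq_conj_mul_self]

theorem aux_pos [Nonempty B] (head tail : E → B ⊕ I)
    (hG : Gconn head tail) (γ : E → ℂ) (hγ : ∀ e, 0 < (γ e).re) (x : I → ℂ) (hx : x ≠ 0) :
    0 < ∑ e, (γ e).re * ‖Sum.elim (0 : B → ℂ) x (head e)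
        - Sum.elim (0 : B → ℂ) x (tail e)‖ ^ 2 := by
  have hnn : ∀ e ∈ Finset.univ, 0 ≤ (γ e).re * ‖Sum.elim (0 : B → ℂ) x (head e)
        - Sum.elim (0 : B → ℂ) x (tail e)‖ ^ 2 := fun e _ =>
    mul_nonneg (hγ e).le (by positivity)
  refine lt_of_le_of_ne (Finset.sum_nonneg hnn) fun h => hx ?_
  have h0 := (Finset.sum_eq_zero_iff_of_nonneg hnn).1 h.symm
  have h1 : ∀ e, Sum.elim (0 : B → ℂ) x (head e) = Sum.elim (0 : B → ℂ) x (tail e) := by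
    intro e
    have := h0 e (Finset.mem_univ e)
    rcases mul_eq_zero.1 this with h | h
    · exact absurd h (hγ e).ne'
    · exact sub_eq_zero.1 (norm_eq_zero.1 (pow_eq_zero_iff (two_ne_zero) |>.1 h))
  have hw : ∀ v w : B ⊕ I, Sum.elim (0 : B → ℂ) x v = Sum.elim (0 : B → ℂ) x w := by
    intro v w
    obtain ⟨p⟩ := hG.preconnected v w
    induction p with
    | nil => rfl
    | cons hadj _ ih =>
      rw [← ih]
      rw [SimpleGraph.fromRel_adj] at hadj
      rcases hadj.2 with ⟨e, rfl, rfl⟩ | ⟨e, rfl, rfl⟩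
      · exact h1 e
      · exact (h1 e).symm
  obtain ⟨b⟩ := ‹Nonempty B›
  funext i
  simpa using hw (Sum.inr i) (Sum.inl b)

/-- If `G` and `G_I` are connected, then for every conductivity
`γ ∈ ℂ_0^E` there is `ζ < 0` such that for every `q ∈ ℂ_ζ^I` the matrix
`(L_γ)_II + diag(q)` is invertible. -/
theorem dirichlet_wellposed [Nonempty B] (head tail : E → B ⊕ I)
    (hG : Gconn head tail) (hGI : GIconn head tail)
    (γ : E → ℂ) (hγ : ∀ e, 0 < (γ e).re) :
    ∃ ζ : ℝ, ζ < 0 ∧ ∀ q : I → ℂ, (∀ i, ζ < (q i).re) →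
      IsUnit (lapII ℂ head tail γ + Matrix.diagonal q) := by
  classical
  haveI : Nonempty I := hGI.nonempty
  have hc : Continuous fun x : I → ℂ => ∑ e, (γ e).re * ‖Sum.elim (0 : B → ℂ) x (head e)
        - Sum.elim (0 : B → ℂ) x (tail e)‖ ^ 2 := by
    have : ∀ v : B ⊕ I, Continuous fun x : I → ℂ => Sum.elim (0 : B → ℂ) x v := by
      rintro (b | j)
      · exact continuous_const
      · exact continuous_apply j
    exact continuous_finsetSum _ fun e _ =>
      continuous_const.mul ((((this _).sub (this _)).norm).pow 2)
  obtain ⟨x₀, hx₀, hmin⟩ := (isCompact_sphere (0 : I → ℂ) 1).exists_isMinOn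
    (NormedSpace.sphere_nonempty.2 zero_le_one) hc.continuousOn
  have hx₀' : x₀ ≠ 0 := by
    rintro rfl
    simp at hx₀
  have hm := aux_pos head tail hG γ hγ x₀ hx₀'
  set m := ∑ e, (γ e).re * ‖Sum.elim (0 : B → ℂ) x₀ (head e)
        - Sum.elim (0 : B → ℂ) x₀ (tail e)‖ ^ 2 with hmdef
  have hcard : (0 : ℝ) < Fintype.card I := by exact_mod_cast Fintype.card_pos
  refine ⟨-(m / (2 * Fintype.card I)), by rw [neg_lt_zero]; positivity, fun q hq => ?_⟩
  rw [Matrix.isUnit_iff_isUnit_det, isUnit_iff_ne_zero]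
  intro hdet
  obtain ⟨y, hy, hy0⟩ := Matrix.exists_mulVec_eq_zero_iff.2 hdet
  have hyn : ‖y‖ ≠ 0 := norm_ne_zero_iff.2 hy
  obtain ⟨x, hx⟩ : ∃ x : I → ℂ, x = ((‖y‖⁻¹ : ℝ) : ℂ) • y := ⟨_, rfl⟩
  have hxn : ‖x‖ = 1 := by
    rw [hx, norm_smul, Complex.norm_real, norm_inv, norm_norm, inv_mul_cancel₀ hyn]
  have hx0 : (lapII ℂ head tail γ + Matrix.diagonal q) *ᵥ x = 0 := by
    rw [hx, Matrix.mulVec_smul, hy0, smul_zero]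
  have h1 := hmin (show x ∈ Metric.sphere (0 : I → ℂ) 1 by simpa using hxn)
  simp only [Set.mem_setOf_eq] at h1
  rw [← hmdef] at h1
  have h2 : star x ⬝ᵥ ((lapII ℂ head tail γ + Matrix.diagonal q) *ᵥ x) = 0 := by
    rw [hx0, dotProduct_zero]
  rw [Matrix.add_mulVec, dotProduct_add, aux_form] at h2
  have h3 : star x ⬝ᵥ (Matrix.diagonal q *ᵥ x) = ∑ i, q i * ((‖x i‖ ^ 2 : ℝ) : ℂ) := by
    rw [dotProduct]
    refine Finset.sum_congr rfl fun i _ => ?_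
    rw [Matrix.mulVec_diagonal, mul_left_comm, ← Complex.normSq_eq_norm_sq,
      Complex.normSq_eq_conj_mul_self]
    rfl
  rw [h3] at h2
  have h4 := congrArg Complex.re h2
  simp only [Complex.add_re, Complex.re_sum, Complex.re_mul_ofReal, Complex.zero_re] at h4
  have h5 : ∑ _i : I, -(m / (2 * Fintype.card I)) ≤ ∑ i, (q i).re * ‖x i‖ ^ 2 := by
    refine Finset.sum_le_sum fun i _ => ?_
    have hxi : ‖x i‖ ≤ 1 := hxn ▸ norm_le_pi_norm x i
    have hxi2 : ‖x i‖ ^ 2 ≤ 1 := pow_le_one₀ (norm_nonneg _) hxi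
    have hp : 0 ≤ m / (2 * Fintype.card I) := by positivity
    have := hq i
    nlinarith [sq_nonneg ‖x i‖]
  rw [Finset.sum_const, Finset.card_univ, nsmul_eq_mul] at h5
  have h6 : (Fintype.card I : ℝ) * -(m / (2 * Fintype.card I)) = -(m / 2) := by
    field_simp
  rw [h6] at h5
  linarith

end

end DIP
end

section
/- Suppose G and the subgraph G_I induced on the interior nodes I are connected and B is nonempty. If γ ∈ ℂ^E satisfies Re γ(e) > 0 for every edge e, then the real symmetric matrix (L_{Re γ})_{II}, the II-block of the weighted graph Laplacian with the real weights Re γ, is positive definite. -/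
/-!
Common setup: a finite graph whose vertex set is partitioned into boundary
nodes `B` and interior nodes `I` (so the vertex set is `B ⊕ I`), with edge
set `E` and a fixed orientation given by maps `head tail : E → B ⊕ I`.
-/

open Matrix MeasureTheory

namespace DIP

noncomputable section

variable {B I E : Type*} [Fintype B] [Fintype I] [Fintype E]
  [DecidableEq B] [DecidableEq I] [DecidableEq E]

/-- If `G` and `G_I` are connected and `B` is nonempty, and
`Re γ(e) > 0` for every edge, then `(L_{Re γ})_II` is positive definite. -/
theorem lapII_re_posDef [Nonempty B] (head tail : E → B ⊕ I)
    (hG : Gconn head tail) (hGI : GIconn head tail)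
    (γ : E → ℂ) (hγ : ∀ e, 0 < (γ e).re) :
    (lapII ℝ head tail fun e => (γ e).re).PosDef := by
  have hD : (Matrix.diagonal fun e => (γ e).re).PosDef := Matrix.PosDef.diagonal hγ
  have hinj : Function.Injective ((incMat ℝ head tail).submatrix id Sum.inr).mulVec := by
    suffices H : ∀ x, ((incMat ℝ head tail).submatrix id Sum.inr).mulVec x = 0 → x = 0 by
      intro x y hxy
      refine sub_eq_zero.1 (H _ ?_)
      rw [Matrix.mulVec_sub]
      exact sub_eq_zero.2 hxy
    intro x hx
    have hu : ∀ e, (Sum.elim 0 x : B ⊕ I → ℝ) (head e) = (Sum.elim 0 x : B ⊕ I → ℝ) (tail e) := by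
      intro e
      have h := congrFun hx e
      have key : ∀ v : B ⊕ I, (∑ i : I, (if (Sum.inr i : B ⊕ I) = v then (1 : ℝ) else 0) * x i)
          = (Sum.elim 0 x : B ⊕ I → ℝ) v := by
        rintro (b | j) <;> simp
      simp only [Matrix.mulVec, dotProduct, Matrix.submatrix_apply, incMat, Matrix.of_apply,
        sub_mul, Finset.sum_sub_distrib, id, Pi.zero_apply, key] at h
      exact sub_eq_zero.1 h
    have hr : ∀ v w : B ⊕ I,
        (SimpleGraph.fromRel fun v w : B ⊕ I => ∃ e, head e = v ∧ tail e = w).Reachable v w →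
        (Sum.elim 0 x : B ⊕ I → ℝ) v = (Sum.elim 0 x : B ⊕ I → ℝ) w := by
      rintro v w ⟨p⟩
      induction p with
      | nil => rfl
      | cons h _ ih =>
        rw [← ih]
        rw [SimpleGraph.fromRel_adj] at h
        rcases h.2 with ⟨e, rfl, rfl⟩ | ⟨e, rfl, rfl⟩
        · exact hu e
        · exact (hu e).symm
    funext i
    obtain ⟨b⟩ := ‹Nonempty B›
    simpa using hr (Sum.inr i) (Sum.inl b) (hG.preconnected _ _)
  have := hD.conjTranspose_mul_mul_same hinj
  convert this using 1
  ext i j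
  simp [lapII, lap, Matrix.mul_apply, Matrix.diagonal_apply]

end

end DIP
end

section
/- Let γ_1, γ_2 ∈ ℂ_0^E be conductivities for which the Dirichlet problems for (γ_1,0) and (γ_2,0) are well-posed, let u be (γ_1,0)-harmonic and let v be (γ_2,0)-harmonic. Then u_B^T (Λ_{γ_1,0} − Λ_{γ_2,0}) v_B = (γ_1 − γ_2)^T [(∇u) ⊙ (∇v)]. -/
/-!
Common setup: a finite graph whose vertex set is partitioned into boundary
nodes `B` and interior nodes `I` (so the vertex set is `B ⊕ I`), with edge
set `E` and a fixed orientation given by maps `head tail : E → B ⊕ I`.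
-/

open Matrix MeasureTheory

namespace DIP

noncomputable section

variable {B I E : Type*} [Fintype B] [Fintype I] [Fintype E]
  [DecidableEq B] [DecidableEq I] [DecidableEq E]

theorem incMat_mulVec (head tail : E → B ⊕ I) (u : B ⊕ I → ℂ) :
    (incMat ℂ head tail) *ᵥ u = grad head tail u := by
  ext e
  simp [incMat, grad, Matrix.mulVec, dotProduct, sub_mul, Finset.sum_sub_distrib, ite_mul]

theorem lap_transpose (head tail : E → B ⊕ I) (γ : E → ℂ) :
    (lap ℂ head tail γ)ᵀ = lap ℂ head tail γ := by
  simp [lap, Matrix.transpose_mul, Matrix.mul_assoc]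

theorem dot_lap (head tail : E → B ⊕ I) (γ : E → ℂ) (x w : B ⊕ I → ℂ) :
    x ⬝ᵥ (lap ℂ head tail γ) *ᵥ w
      = ∑ e, γ e * (grad head tail x e * grad head tail w e) := by
  have : (lap ℂ head tail γ) *ᵥ w
      = (incMat ℂ head tail)ᵀ *ᵥ (Matrix.diagonal γ *ᵥ grad head tail w) := by
    rw [← incMat_mulVec, lap, Matrix.mulVec_mulVec, Matrix.mulVec_mulVec, Matrix.mul_assoc]
  rw [this, Matrix.dotProduct_mulVec, Matrix.vecMul_transpose, incMat_mulVec]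
  simp only [dotProduct, Matrix.mulVec_diagonal]
  exact Finset.sum_congr rfl fun e _ => by ring

theorem dtn_transpose (head tail : E → B ⊕ I) (γ : E → ℂ) :
    (dtn head tail γ 0)ᵀ = dtn head tail γ 0 := by
  have hBB : (lapBB ℂ head tail γ)ᵀ = lapBB ℂ head tail γ := by
    rw [lapBB, Matrix.transpose_submatrix, lap_transpose]
  have hII : (lapII ℂ head tail γ)ᵀ = lapII ℂ head tail γ := by
    rw [lapII, Matrix.transpose_submatrix, lap_transpose]
  have hBI : (lapBI ℂ head tail γ)ᵀ = lapIB ℂ head tail γ := by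
    rw [lapBI, Matrix.transpose_submatrix, lap_transpose, lapIB]
  have hIB : (lapIB ℂ head tail γ)ᵀ = lapBI ℂ head tail γ := by
    rw [lapIB, Matrix.transpose_submatrix, lap_transpose, lapBI]
  simp only [dtn, Matrix.transpose_sub, Matrix.transpose_mul, Matrix.transpose_nonsing_inv,
    Matrix.transpose_add, Matrix.diagonal_transpose, hBB, hII, hBI, hIB, Matrix.mul_assoc]

theorem dtn_mulVec (head tail : E → B ⊕ I) (γ : E → ℂ)
    (h : IsUnit (lapII ℂ head tail γ)) (w : B ⊕ I → ℂ) (hw : Harmonic head tail γ 0 w) (b : B) :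
    (dtn head tail γ 0 *ᵥ (fun b => w (Sum.inl b))) b
      = ((lap ℂ head tail γ) *ᵥ w) (Sum.inl b) := by
  have hI : lapIB ℂ head tail γ *ᵥ (fun b => w (Sum.inl b))
      = - (lapII ℂ head tail γ *ᵥ (fun i => w (Sum.inr i))) := by
    ext i
    have := hw i
    simp only [Matrix.mulVec, dotProduct, Fintype.sum_sum_type, Pi.zero_apply, zero_mul,
      add_zero] at this
    simpa [lapIB, lapII, Matrix.mulVec, dotProduct] using eq_neg_of_add_eq_zero_left this
  have hd : IsUnit (lapII ℂ head tail γ).det := (Matrix.isUnit_iff_isUnit_det _).1 h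
  have e0 : lapII ℂ head tail γ + Matrix.diagonal (0 : I → ℂ) = lapII ℂ head tail γ := by
    ext i j; simp [Matrix.diagonal_apply]
  rw [dtn, e0, Matrix.sub_mulVec, ← Matrix.mulVec_mulVec, hI, ← Matrix.mulVec_mulVec,
    Matrix.mulVec_neg, Matrix.mulVec_mulVec _ (lapII ℂ head tail γ)⁻¹,
    Matrix.nonsing_inv_mul _ hd, Matrix.one_mulVec, Matrix.mulVec_neg, sub_neg_eq_add]
  simp [lapBB, lapBI, Matrix.mulVec, dotProduct, Fintype.sum_sum_type]

theorem dot_dtn (head tail : E → B ⊕ I) (γ : E → ℂ)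
    (h : IsUnit (lapII ℂ head tail γ)) (x w : B ⊕ I → ℂ) (hw : Harmonic head tail γ 0 w) :
    (fun b => x (Sum.inl b)) ⬝ᵥ dtn head tail γ 0 *ᵥ (fun b => w (Sum.inl b))
      = ∑ e, γ e * (grad head tail x e * grad head tail w e) := by
  rw [← dot_lap]
  have h0 : ∀ i, ((lap ℂ head tail γ) *ᵥ w) (Sum.inr i) = 0 := fun i => by simpa using hw i
  simp only [dotProduct, Fintype.sum_sum_type, h0, dtn_mulVec head tail γ h w hw, mul_zero,
    Finset.sum_const_zero, add_zero]

/-- interior identity for conductivities: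
`u_Bᵀ (Λ_{γ₁,0} - Λ_{γ₂,0}) v_B = (γ₁ - γ₂)ᵀ [(∇u) ⊙ (∇v)]`. -/
theorem interior_identity_cond [Nonempty B] (head tail : E → B ⊕ I)
    (γ₁ γ₂ : E → ℂ) (hγ₁ : ∀ e, 0 < (γ₁ e).re) (hγ₂ : ∀ e, 0 < (γ₂ e).re)
    (h₁ : IsUnit (lapII ℂ head tail γ₁)) (h₂ : IsUnit (lapII ℂ head tail γ₂))
    (u v : B ⊕ I → ℂ)
    (hu : Harmonic head tail γ₁ 0 u) (hv : Harmonic head tail γ₂ 0 v) :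
    (fun b => u (Sum.inl b)) ⬝ᵥ
        (dtn head tail γ₁ 0 - dtn head tail γ₂ 0).mulVec (fun b => v (Sum.inl b)) =
      (fun e => γ₁ e - γ₂ e) ⬝ᵥ (fun e => grad head tail u e * grad head tail v e) := by
  rw [Matrix.sub_mulVec, dotProduct_sub, dot_dtn head tail γ₂ h₂ u v hv,
    Matrix.dotProduct_mulVec, ← Matrix.mulVec_transpose, dtn_transpose, dotProduct_comm,
    dot_dtn head tail γ₁ h₁ v u hu, ← Finset.sum_sub_distrib]
  simp only [dotProduct]
  exact Finset.sum_congr rfl fun e _ => by ring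

end

end DIP
end

section
/- Assume G and the subgraph G_I induced on the interior nodes are connected. If there exists ρ ∈ ℂ_0^E with P(ρ,ρ) = ℂ^E, then the set {γ ∈ ℂ_0^E : P(γ,γ) ≠ ℂ^E} has Lebesgue measure zero in ℂ^E; that is, the linearized inverse conductivity problem is solvable at almost every γ ∈ ℂ_0^E. -/
/-!
Common setup: a finite graph whose vertex set is partitioned into boundary
nodes `B` and interior nodes `I` (so the vertex set is `B ⊕ I`), with edge
set `E` and a fixed orientation given by maps `head tail : E → B ⊕ I`.
-/

open Matrix MeasureTheory

namespace DIP

noncomputable section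

variable {B I E : Type*} [Fintype B] [Fintype I] [Fintype E]
  [DecidableEq B] [DecidableEq I] [DecidableEq E]

def Wm (α : Type*) [CommRing α] (head tail : E → B ⊕ I) (γ : E → α) : Matrix (B ⊕ I) B α :=
  Matrix.of (Sum.elim (fun b i => if b = i then (lapII α head tail γ).det else 0)
    (fun j i => (-((lapII α head tail γ).adjugate * lapIB α head tail γ)) j i))

def Fm (α : Type*) [CommRing α] (head tail : E → B ⊕ I) (γ : E → α) : Matrix E (B × B) α :=
  Matrix.of fun e p =>
    (Wm α head tail γ (head e) p.1 - Wm α head tail γ (tail e) p.1) *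
    (Wm α head tail γ (head e) p.2 - Wm α head tail γ (tail e) p.2)

lemma lap_map {α β : Type*} [CommRing α] [CommRing β] (f : α →+* β) (head tail : E → B ⊕ I)
    (γ : E → α) (v w : B ⊕ I) :
    f (lap α head tail γ v w) = lap β head tail (fun e => f (γ e)) v w := by
  simp only [lap, Matrix.mul_apply, Matrix.transpose_apply, incMat,
    Matrix.of_apply, map_sum, map_mul, map_sub, apply_ite f, map_one, map_zero, Matrix.diagonal_apply]

lemma Wm_map {α β : Type*} [CommRing α] [CommRing β] (f : α →+* β) (head tail : E → B ⊕ I)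
    (γ : E → α) (v : B ⊕ I) (b : B) :
    f (Wm α head tail γ v b) = Wm β head tail (fun e => f (γ e)) v b := by
  have h1 : f.mapMatrix (lapII α head tail γ) = lapII β head tail (fun e => f (γ e)) := by
    ext i j; simp [lapII, lap_map]
  have h2 : ∀ i b, f (lapIB α head tail γ i b) = lapIB β head tail (fun e => f (γ e)) i b := by
    intro i b; simp [lapIB, lap_map]
  have h3 : ∀ i j, f ((lapII α head tail γ).adjugate i j)
      = (lapII β head tail (fun e => f (γ e))).adjugate i j := by
    intro i j
    rw [← h1, ← RingHom.map_adjugate]; rfl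
  rcases v with v | v
  · simp only [Wm, Matrix.of_apply, Sum.elim_inl, apply_ite f, map_zero]
    rw [RingHom.map_det, h1]
  · simp only [Wm, Matrix.of_apply, Sum.elim_inr, Matrix.neg_apply, Matrix.mul_apply, map_neg,
      map_sum, map_mul, h2, h3]

lemma Fm_map {α β : Type*} [CommRing α] [CommRing β] (f : α →+* β) (head tail : E → B ⊕ I)
    (γ : E → α) :
    (Fm α head tail γ).map f = Fm β head tail (fun e => f (γ e)) := by
  ext e p
  simp [Fm, Wm_map]

lemma lap_mulVec_inr (head tail : E → B ⊕ I) (γ : E → ℂ) (u : B ⊕ I → ℂ) (i : I) :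
    (lap ℂ head tail γ).mulVec u (Sum.inr i) =
      (lapIB ℂ head tail γ).mulVec (fun b => u (Sum.inl b)) i +
      (lapII ℂ head tail γ).mulVec (fun j => u (Sum.inr j)) i := by
  simp [Matrix.mulVec, dotProduct, Fintype.sum_sum_type, lapIB, lapII]

lemma Wm_harmonic (head tail : E → B ⊕ I) (γ : E → ℂ) (b : B) :
    Harmonic head tail γ 0 (fun v => Wm ℂ head tail γ v b) := by
  intro i
  rw [lap_mulVec_inr]
  have h : (lapII ℂ head tail γ).mulVec (fun j => Wm ℂ head tail γ (Sum.inr j) b) i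
      = (lapII ℂ head tail γ * (-((lapII ℂ head tail γ).adjugate * lapIB ℂ head tail γ))) i b := by
    rfl
  rw [h, Matrix.mul_neg, ← Matrix.mul_assoc, Matrix.mul_adjugate]
  simp [Wm, Matrix.mulVec, dotProduct]
  ring

lemma harmonic_eq (head tail : E → B ⊕ I) (γ : E → ℂ) (hd : (lapII ℂ head tail γ).det ≠ 0)
    (u : B ⊕ I → ℂ) (hu : Harmonic head tail γ 0 u) :
    u = (Wm ℂ head tail γ).mulVec (fun b => ((lapII ℂ head tail γ).det)⁻¹ * u (Sum.inl b)) := by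
  set d := (lapII ℂ head tail γ).det with hdd
  have h1 : (lapIB ℂ head tail γ).mulVec (fun b => u (Sum.inl b)) +
      (lapII ℂ head tail γ).mulVec (fun j => u (Sum.inr j)) = 0 := by
    ext i
    have := hu i
    rw [lap_mulVec_inr] at this
    simpa using this
  have h2 := congrArg ((lapII ℂ head tail γ).adjugate.mulVec) h1
  rw [Matrix.mulVec_add, Matrix.mulVec_mulVec, Matrix.mulVec_mulVec, Matrix.adjugate_mul,
    Matrix.mulVec_zero] at h2
  ext v
  rcases v with b | j
  · simp [Wm, Matrix.mulVec, dotProduct, ← hdd, hd]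
  · have h3 := congrFun h2 j
    simp only [Pi.add_apply, Matrix.smul_mulVec, Matrix.one_mulVec, Pi.smul_apply, smul_eq_mul,
      Pi.zero_apply, ← hdd] at h3
    have h4 : (Wm ℂ head tail γ).mulVec (fun b => d⁻¹ * u (Sum.inl b)) (Sum.inr j)
      = - (d⁻¹ * ((lapII ℂ head tail γ).adjugate * lapIB ℂ head tail γ).mulVec
          (fun b => u (Sum.inl b)) j) := by
      simp only [Matrix.mulVec, dotProduct, Wm, Matrix.of_apply, Sum.elim_inr, Matrix.neg_apply,
        Finset.mul_sum, ← Finset.sum_neg_distrib]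
      refine Finset.sum_congr rfl fun b _ => ?_
      ring
    rw [h4]
    field_simp
    linear_combination h3

lemma det_ne (head tail : E → B ⊕ I) [Nonempty B] (hG : Gconn head tail)
    (ρ : E → ℂ) (hρ : ∀ e, 0 < (ρ e).re) : (lapII ℂ head tail ρ).det ≠ 0 := by
  intro h0
  obtain ⟨x, hx, hx0⟩ := Matrix.exists_mulVec_eq_zero_iff.mpr h0
  apply hx
  let u : B ⊕ I → ℂ := Sum.elim (fun _ => 0) x
  have hu : ∀ i, (lap ℂ head tail ρ).mulVec u (Sum.inr i) = 0 := by
    intro i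
    rw [lap_mulVec_inr]
    have h1 : (fun b => u (Sum.inl b)) = (0 : B → ℂ) := rfl
    have h2 : (fun b => u (Sum.inr b)) = x := rfl
    rw [h1, h2, hx0]; simp
  have hinc : ∀ w : B ⊕ I → ℂ, (incMat ℂ head tail).mulVec w = grad head tail w := by
    intro w; ext e
    simp [incMat, Matrix.mulVec, dotProduct, grad, sub_mul, Finset.sum_sub_distrib]
  have hs : ∑ e, ρ e * (grad head tail u e * star (grad head tail u e)) = 0 := by
    have h1 : star u ⬝ᵥ (lap ℂ head tail ρ).mulVec u = 0 := by
      simp only [dotProduct, Fintype.sum_sum_type, hu]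
      simp [u]
    rw [lap, ← Matrix.mulVec_mulVec, ← Matrix.mulVec_mulVec, Matrix.dotProduct_mulVec,
      Matrix.vecMul_transpose, hinc, hinc] at h1
    rw [← h1]
    simp only [dotProduct, Matrix.mulVec_diagonal]
    refine Finset.sum_congr rfl fun e _ => ?_
    simp [grad]; ring
  have hz : ∀ e, grad head tail u e = 0 := by
    have h1 := congrArg Complex.re hs
    simp only [Complex.re_sum, Complex.star_def, Complex.mul_conj, Complex.re_mul_ofReal,
      Complex.zero_re] at h1
    rw [Finset.sum_eq_zero_iff_of_nonneg
      (fun e _ => mul_nonneg (hρ e).le (Complex.normSq_nonneg _))] at h1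
    intro e
    have := h1 e (Finset.mem_univ e)
    rcases mul_eq_zero.mp this with h | h
    · exact absurd h (hρ e).ne'
    · exact Complex.normSq_eq_zero.mp h
  have hadj : ∀ v w, (SimpleGraph.fromRel fun v w : B ⊕ I => ∃ e, head e = v ∧ tail e = w).Adj v w
      → u v = u w := by
    intro v w h
    rw [SimpleGraph.fromRel_adj] at h
    rcases h with ⟨_, ⟨e, rfl, rfl⟩ | ⟨e, rfl, rfl⟩⟩
    · exact sub_eq_zero.mp (hz e)
    · exact (sub_eq_zero.mp (hz e)).symm
  have hc : ∀ v w, u v = u w := by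
    intro v w
    obtain ⟨p⟩ := hG.preconnected v w
    induction p with
    | nil => rfl
    | cons h _ ih => exact (hadj _ _ h).trans ih
  ext i
  exact hc (Sum.inr i) (Sum.inl (Classical.arbitrary B))

lemma P_le (head tail : E → B ⊕ I) (γ : E → ℂ) (hd : (lapII ℂ head tail γ).det ≠ 0) :
    Pspace head tail γ γ ≤ LinearMap.range (Fm ℂ head tail γ).mulVecLin := by
  refine Submodule.span_le.mpr ?_
  rintro w ⟨u, v, hu, hv, rfl⟩
  rw [harmonic_eq head tail γ hd u hu, harmonic_eq head tail γ hd v hv]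
  generalize (fun b => ((lapII ℂ head tail γ).det)⁻¹ * u (Sum.inl b)) = a
  generalize (fun b => ((lapII ℂ head tail γ).det)⁻¹ * v (Sum.inl b)) = c
  refine ⟨fun p => a p.1 * c p.2, ?_⟩
  ext e
  simp only [Matrix.mulVecLin_apply, Matrix.mulVec, dotProduct, grad, Fm, Matrix.of_apply,
    ← Finset.sum_sub_distrib, Fintype.sum_prod_type, Finset.sum_mul_sum]
  refine Finset.sum_congr rfl fun b _ => Finset.sum_congr rfl fun b' _ => ?_
  ring

lemma le_P (head tail : E → B ⊕ I) (γ : E → ℂ) :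
    LinearMap.range (Fm ℂ head tail γ).mulVecLin ≤ Pspace head tail γ γ := by
  rw [Matrix.range_mulVecLin]
  refine Submodule.span_mono ?_
  rintro _ ⟨p, rfl⟩
  exact ⟨_, _, Wm_harmonic head tail γ p.1, Wm_harmonic head tail γ p.2, rfl⟩

lemma poly_null (p : MvPolynomial E ℂ) (ρ : E → ℂ) (h : MvPolynomial.eval ρ p ≠ 0) :
    volume {γ : E → ℂ | MvPolynomial.eval γ p = 0} = 0 := by
  have hcont : Continuous fun γ : E → ℂ => MvPolynomial.eval γ p := p.continuous_eval
  let S : Set ((E → ℂ) × ℝ) := {z | MvPolynomial.eval (ρ + z.2 • z.1) p = 0}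
  have hS : MeasurableSet S := by
    have : Continuous fun z : (E → ℂ) × ℝ => MvPolynomial.eval (ρ + z.2 • z.1) p :=
      hcont.comp (by fun_prop)
    exact (isClosed_singleton.preimage this).measurableSet
  have hnull : ((volume : Measure (E → ℂ)).prod (volume : Measure ℝ)) S = 0 := by
    rw [Measure.measure_prod_null hS]
    refine Filter.Eventually.of_forall fun x => ?_
    let q : Polynomial ℂ := MvPolynomial.aeval
      (fun e => Polynomial.C (ρ e) + Polynomial.X * Polynomial.C (x e)) p
    have hq : ∀ t : ℂ, q.eval t = MvPolynomial.eval (fun e => ρ e + t * x e) p := by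
      intro t
      have := MvPolynomial.map_aeval (R := ℂ)
        (fun e => Polynomial.C (ρ e) + Polynomial.X * Polynomial.C (x e))
        (Polynomial.evalRingHom t) p
      simp only [Polynomial.coe_evalRingHom] at this
      change Polynomial.eval t (MvPolynomial.aeval _ p) = _
      rw [this]
      have hc : (Polynomial.evalRingHom t).comp (algebraMap ℂ (Polynomial ℂ)) = RingHom.id ℂ := by
        ext z; simp
      rw [hc]
      simp only [Polynomial.eval_add, Polynomial.eval_mul, Polynomial.eval_C, Polynomial.eval_X]
      rfl
    have hq0 : q ≠ 0 := by
      intro h0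
      apply h
      have := hq 0
      rw [h0] at this
      simpa using this.symm
    have hfin : (Prod.mk x ⁻¹' S).Finite := by
      refine ((Polynomial.finite_setOfPred_isRoot hq0).preimage
        (f := fun t : ℝ => (t : ℂ)) Complex.ofReal_injective.injOn).subset ?_
      intro t ht
      change q.eval (t : ℂ) = 0
      rw [hq]
      exact ht
    exact hfin.measure_zero _
  have hsw : ∀ᵐ t : ℝ, volume {x : E → ℂ | MvPolynomial.eval (ρ + t • x) p = 0} = 0 := by
    have hae : ∀ᵐ z ∂((volume : Measure (E → ℂ)).prod (volume : Measure ℝ)),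
        ¬ MvPolynomial.eval (ρ + z.2 • z.1) p = 0 := by
      rw [ae_iff]; simpa [S] using hnull
    have := (Measure.ae_ae_comm (μ := (volume : Measure (E → ℂ))) (ν := (volume : Measure ℝ))
      (p := fun x t => ¬ MvPolynomial.eval (ρ + t • x) p = 0) hS.compl).mp
      (Measure.ae_ae_of_ae_prod hae)
    filter_upwards [this] with t ht
    rw [ae_iff] at ht
    simpa using ht
  have hne : ∀ᵐ t : ℝ, t ≠ 0 := by simp [ae_iff]
  obtain ⟨t, ht, ht0⟩ := (hsw.and hne).exists
  have e1 : {x : E → ℂ | MvPolynomial.eval (ρ + t • x) p = 0}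
      = (fun x => t • x) ⁻¹' ((fun x => ρ + x) ⁻¹' {γ : E → ℂ | MvPolynomial.eval γ p = 0}) := rfl
  rw [e1, Measure.addHaar_preimage_smul _ ht0, measure_preimage_add] at ht
  rcases mul_eq_zero.mp ht with h' | h'
  · rw [ENNReal.ofReal_eq_zero] at h'
    exact absurd h' (not_le.mpr (abs_pos.mpr (inv_ne_zero (pow_ne_zero _ ht0))))
  · exact h'

/-- if the linearized problem is solvable at some `ρ ∈ ℂ_0^E`,
then the set of `γ ∈ ℂ_0^E` where it is not solvable has measure zero. -/
theorem linearized_solvable_ae_cond [Nonempty B] (head tail : E → B ⊕ I)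
    (hG : Gconn head tail) (hGI : GIconn head tail)
    (ρ : E → ℂ) (hρ : ∀ e, 0 < (ρ e).re) (hP : Pspace head tail ρ ρ = ⊤) :
    volume { γ : E → ℂ | (∀ e, 0 < (γ e).re) ∧ Pspace head tail γ γ ≠ ⊤ } = 0 := by
  have hd := det_ne head tail hG ρ hρ
  have hsurj : Function.Surjective (Fm ℂ head tail ρ).mulVec := by
    have : LinearMap.range (Fm ℂ head tail ρ).mulVecLin = ⊤ :=
      top_le_iff.mp (hP ▸ P_le head tail ρ hd)
    exact LinearMap.range_eq_top.mp this
  obtain ⟨R, hR⟩ := Matrix.mulVec_surjective_iff_exists_right_inverse.mp hsurj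
  let R' : Matrix (B × B) E (MvPolynomial E ℂ) := R.map MvPolynomial.C
  let M : Matrix E E (MvPolynomial E ℂ) := Fm (MvPolynomial E ℂ) head tail MvPolynomial.X * R'
  let p : MvPolynomial E ℂ := Matrix.det M
  have hp : ∀ γ, MvPolynomial.eval γ p = (Fm ℂ head tail γ * R).det := by
    intro γ
    change MvPolynomial.eval γ (Matrix.det M) = _
    rw [RingHom.map_det, RingHom.mapMatrix_apply]
    simp only [M]
    rw [Matrix.map_mul, Fm_map]
    congr 2
    · simp
    · ext; simp [R']
  refine measure_mono_null ?_ (poly_null p ρ (by rw [hp, hR]; simp))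
  rintro γ ⟨-, hγ⟩
  by_contra hne
  apply hγ
  have hne' : (Fm ℂ head tail γ * R).det ≠ 0 := by rw [← hp]; exact hne
  rw [← top_le_iff]
  refine le_trans ?_ (le_P head tail γ)
  intro w _
  refine ⟨R.mulVec ((Fm ℂ head tail γ * R)⁻¹.mulVec w), ?_⟩
  rw [Matrix.mulVecLin_apply, Matrix.mulVec_mulVec, Matrix.mulVec_mulVec,
    Matrix.mul_nonsing_inv _ (isUnit_iff_ne_zero.mpr hne'), Matrix.one_mulVec]

end

end DIP
end

section
/- Let γ ∈ ℂ_0^E and q_1, q_2 ∈ ℂ^I be such that the Dirichlet problems for (γ,q_1) and (γ,q_2) are well-posed. Let u be (γ,q_1)-harmonic and v be (γ,q_2)-harmonic. Then u_B^T (Λ_{γ,q_1} − Λ_{γ,q_2}) v_B = u_I^T diag(q_1 − q_2) v_I = (q_1 − q_2)^T (u_I ⊙ v_I). -/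
/-!
Common setup: a finite graph whose vertex set is partitioned into boundary
nodes `B` and interior nodes `I` (so the vertex set is `B ⊕ I`), with edge
set `E` and a fixed orientation given by maps `head tail : E → B ⊕ I`.
-/

open Matrix MeasureTheory

namespace DIP

noncomputable section

variable {B I E : Type*} [Fintype B] [Fintype I] [Fintype E]
  [DecidableEq B] [DecidableEq I] [DecidableEq E]

/-- interior identity for Schrödinger potentials:
`u_Bᵀ (Λ_{γ,q₁} - Λ_{γ,q₂}) v_B = u_Iᵀ diag(q₁ - q₂) v_I = (q₁ - q₂)ᵀ (u_I ⊙ v_I)`. -/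
theorem interior_identity_schroe [Nonempty B] (head tail : E → B ⊕ I)
    (γ : E → ℂ) (hγ : ∀ e, 0 < (γ e).re) (q₁ q₂ : I → ℂ)
    (h₁ : IsUnit (lapII ℂ head tail γ + Matrix.diagonal q₁))
    (h₂ : IsUnit (lapII ℂ head tail γ + Matrix.diagonal q₂))
    (u v : B ⊕ I → ℂ)
    (hu : Harmonic head tail γ q₁ u) (hv : Harmonic head tail γ q₂ v) :
    (fun b => u (Sum.inl b)) ⬝ᵥ
        (dtn head tail γ q₁ - dtn head tail γ q₂).mulVec (fun b => v (Sum.inl b)) =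
      (fun i => u (Sum.inr i)) ⬝ᵥ
        (Matrix.diagonal (q₁ - q₂)).mulVec (fun i => v (Sum.inr i)) ∧
    (fun i => u (Sum.inr i)) ⬝ᵥ
        (Matrix.diagonal (q₁ - q₂)).mulVec (fun i => v (Sum.inr i)) =
      (fun i => q₁ i - q₂ i) ⬝ᵥ (fun i => u (Sum.inr i) * v (Sum.inr i)) := by
  set L := lap ℂ head tail γ with hL
  have hsym : Lᵀ = L := by
    simp [hL, lap, Matrix.transpose_mul, Matrix.mul_assoc]
  set uB : B → ℂ := fun b => u (Sum.inl b) with huB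
  set vB : B → ℂ := fun b => v (Sum.inl b) with hvB
  set uI : I → ℂ := fun i => u (Sum.inr i) with huI
  set vI : I → ℂ := fun i => v (Sum.inr i) with hvI
  have key : ∀ (q : I → ℂ) (w : B ⊕ I → ℂ), Harmonic head tail γ q w →
      (lapIB ℂ head tail γ) *ᵥ (fun b => w (Sum.inl b)) =
        -((lapII ℂ head tail γ + Matrix.diagonal q) *ᵥ (fun i => w (Sum.inr i))) := by
    intro q w hw
    funext i
    have h := hw i
    simp only [Matrix.mulVec, dotProduct, Fintype.sum_sum_type] at h
    rw [Matrix.add_mulVec]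
    simp only [Pi.neg_apply, Pi.add_apply, Matrix.mulVec_diagonal]
    simp only [Matrix.mulVec, dotProduct, lapIB, lapII, Matrix.submatrix_apply]
    linear_combination h
  have hT : lapBI ℂ head tail γ = (lapIB ℂ head tail γ)ᵀ := by
    ext b i
    exact (congrFun (congrFun hsym (Sum.inl b)) (Sum.inr i)).symm
  have hAT : ∀ q : I → ℂ, (lapII ℂ head tail γ + Matrix.diagonal q)ᵀ =
      lapII ℂ head tail γ + Matrix.diagonal q := by
    intro q
    rw [Matrix.transpose_add, Matrix.diagonal_transpose]
    congr 1
    ext i j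
    exact congrFun (congrFun hsym (Sum.inr i)) (Sum.inr j)
  have k1 := key q₁ u hu
  have k2 := key q₂ v hv
  have d1 := (Matrix.isUnit_iff_isUnit_det _).1 h₁
  have d2 := (Matrix.isUnit_iff_isUnit_det _).1 h₂
  have hd : lapII ℂ head tail γ + Matrix.diagonal q₁ =
      (lapII ℂ head tail γ + Matrix.diagonal q₂) + Matrix.diagonal (q₁ - q₂) := by
    rw [add_assoc, Matrix.diagonal_add]
    congr 2
    funext i
    simp
  have t1 := hAT q₁
  constructor
  · unfold dtn
    rw [hT]
    generalize lapII ℂ head tail γ + Matrix.diagonal q₁ = A₁ at *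
    generalize lapII ℂ head tail γ + Matrix.diagonal q₂ = A₂ at *
    generalize lapIB ℂ head tail γ = M at *
    have e1 : uB ⬝ᵥ (Mᵀ * A₁⁻¹ * M) *ᵥ vB = uI ⬝ᵥ A₂ *ᵥ vI := by
      rw [← Matrix.mulVec_mulVec, k2, Matrix.dotProduct_mulVec, ← Matrix.vecMul_vecMul,
        Matrix.vecMul_transpose, k1, Matrix.neg_vecMul, ← Matrix.vecMul_transpose, t1,
        Matrix.vecMul_vecMul, Matrix.mul_nonsing_inv _ d1, Matrix.vecMul_one]
      simp [huI, hvI]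
    have e2 : uB ⬝ᵥ (Mᵀ * A₂⁻¹ * M) *ᵥ vB = uI ⬝ᵥ A₁ *ᵥ vI := by
      rw [Matrix.mul_assoc, ← Matrix.mulVec_mulVec, ← Matrix.mulVec_mulVec, k2,
        Matrix.mulVec_neg, Matrix.mulVec_mulVec, Matrix.nonsing_inv_mul _ d2,
        Matrix.one_mulVec, Matrix.dotProduct_mulVec, Matrix.vecMul_transpose, k1,
        ← Matrix.vecMul_transpose, t1, Matrix.dotProduct_mulVec]
      simp [huI, hvI]
    rw [Matrix.sub_mulVec, Matrix.sub_mulVec, Matrix.sub_mulVec, dotProduct_sub,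
      dotProduct_sub, dotProduct_sub, e1, e2, hd, Matrix.add_mulVec, dotProduct_add]
    ring
  · simp only [dotProduct, Matrix.mulVec_diagonal, Pi.sub_apply]
    refine Finset.sum_congr rfl fun i _ => ?_
    ring

end

end DIP
end
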